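/- arXiv:1307.3877 — 8 statements merged into one kernel-verified Lean document; each statement's English description precedes it below -/
import Mathlib

section
/- For every natural number n ≥ 1, the number of idempotent functions from [n] to itself equals the sum over k from 1 to n of C(n,k)·k^(n−k), where C(n,k) denotes the binomial coefficient. -/
open Finset in
/-- The idempotent self-maps with fixed-point set `s` are the maps into `s` that fix `s`
pointwise. -/
lemma filter_idempotent_fixedPoints_eq {α : Type*} [Fintype α] [DecidableEq α] (s : Finset α) :
    ({f : α → α | (∀ x, f (f x) = f x) ∧ ({x | f x = x} : Finset α) = s} : Finset (α → α)) =
      Fintype.piFinset fun x => if x ∈ s then {x} else s := by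
  ext f
  simp only [mem_filter, mem_univ, true_and, Fintype.mem_piFinset]
  constructor
  · rintro ⟨hf, rfl⟩ x
    by_cases hx : f x = x <;> simp [hx, hf]
  · intro h
    have hfix : ∀ x ∈ s, f x = x := fun x hx => by simpa [hx] using h x
    have hmem : ∀ x, f x ∈ s := fun x => by
      by_cases hx : x ∈ s
      · rwa [hfix x hx]
      · simpa [hx] using h x
    refine ⟨fun x => hfix _ (hmem x), ?_⟩
    ext x
    simp only [mem_filter, mem_univ, true_and]
    exact ⟨fun hx => hx ▸ hmem x, hfix x⟩

open Finset in
lemma card_filter_idempotent_fixedPoints_eq {α : Type*} [Fintype α] [DecidableEq α]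
    (s : Finset α) :
    #{f : α → α | (∀ x, f (f x) = f x) ∧ ({x | f x = x} : Finset α) = s} =
      #s ^ (Fintype.card α - #s) := by
  rw [filter_idempotent_fixedPoints_eq, Fintype.card_piFinset]
  simp only [apply_ite card, card_singleton, prod_ite, prod_const_one, one_mul, prod_const]
  rw [← card_compl]
  congr 2
  ext x
  simp

open Finset in
lemma card_idempotent_eq_sum_range {α : Type*} [Fintype α] [DecidableEq α] :
    Nat.card {f : α → α // ∀ x, f (f x) = f x} =
      ∑ k ∈ range (Fintype.card α + 1), (Fintype.card α).choose k * k ^ (Fintype.card α - k) := by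
  rw [Nat.card_eq_fintype_card, Fintype.card_subtype,
    card_eq_sum_card_fiberwise (t := univ.powerset)
      (f := fun f : α → α => ({x | f x = x} : Finset α)) (by intro f _; simp)]
  simp only [filter_filter, card_filter_idempotent_fixedPoints_eq]
  rw [sum_powerset_apply_card (fun k => k ^ (Fintype.card α - k)), card_univ]
  simp only [smul_eq_mul]

/-- The number of idempotent functions from `[n]` (modeled as `Fin n`) to itself
equals `∑_{k=1}^{n} C(n,k) · k^(n-k)`. -/
theorem card_idempotent_maps (n : ℕ) (hn : 1 ≤ n) :
    Nat.card {f : Fin n → Fin n // ∀ x, f (f x) = f x} =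
      ∑ k ∈ Finset.Icc 1 n, n.choose k * k ^ (n - k) := by
  rw [card_idempotent_eq_sum_range, Fintype.card_fin,
    Finset.sum_range_eq_add_Ico _ n.succ_pos]
  simp [zero_pow (Nat.one_le_iff_ne_zero.mp hn), Finset.Ico_add_one_right_eq_Icc]
end

section
/- For every natural number n ≥ 1 and every k with 1 ≤ k ≤ n, the number of idempotent functions from [n] to itself whose image has exactly k elements equals C(n,k)·k^(n−k). -/
/-- The idempotent maps with image `s` are the maps into `s` that fix `s` pointwise. -/
theorem idempotent_and_image_eq_iff {α : Type*} [Fintype α] [DecidableEq α]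
    (s : Finset α) (f : α → α) :
    ((∀ x, f (f x) = f x) ∧ Finset.univ.image f = s) ↔
      f ∈ Fintype.piFinset fun x => if x ∈ s then {x} else s := by
  rw [Fintype.mem_piFinset]
  constructor
  · rintro ⟨hf, rfl⟩ x
    split_ifs with hx
    · obtain ⟨y, -, rfl⟩ := Finset.mem_image.1 hx
      simp [hf y]
    · simp
  · intro h
    have hfix : ∀ x ∈ s, f x = x := fun x hx => by simpa [hx] using h x
    have hmem : ∀ x, f x ∈ s := fun x => by
      by_cases hx : x ∈ s
      · rwa [hfix x hx]
      · simpa [hx] using h x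
    refine ⟨fun x => hfix _ (hmem x), Finset.Subset.antisymm ?_ ?_⟩
    · exact Finset.image_subset_iff.2 fun x _ => hmem x
    · exact fun x hx => Finset.mem_image.2 ⟨x, Finset.mem_univ x, hfix x hx⟩

theorem card_filter_idempotent_image_eq {α : Type*} [Fintype α] [DecidableEq α] (s : Finset α) :
    (Finset.univ.filter fun f : α → α =>
        (∀ x, f (f x) = f x) ∧ Finset.univ.image f = s).card =
      s.card ^ (Fintype.card α - s.card) := by
  simp_rw [idempotent_and_image_eq_iff, Finset.filter_univ_mem, Fintype.card_piFinset,
    apply_ite Finset.card, Finset.card_singleton]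
  rw [Finset.prod_ite, Finset.prod_const_one, one_mul, Finset.prod_const,
    Finset.filter_not, Finset.filter_univ_mem, ← Finset.compl_eq_univ_sdiff, Finset.card_compl]

/-- The number of idempotent functions from `[n]` (modeled as `Fin n`) to itself
whose image has exactly `k` elements equals `C(n,k) · k^(n-k)`. -/
theorem card_idempotent_maps_image_card (n k : ℕ) (hn : 1 ≤ n) (hk1 : 1 ≤ k) (hkn : k ≤ n) :
    Nat.card {f : Fin n → Fin n //
        (∀ x, f (f x) = f x) ∧ (Finset.univ.image f).card = k} =
      n.choose k * k ^ (n - k) := by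
  rw [Nat.card_eq_fintype_card, Fintype.card_subtype,
    Finset.card_eq_sum_card_fiberwise (f := fun f => Finset.univ.image f)
      (t := Finset.univ.powersetCard k)
      (fun f hf => by simpa [Finset.mem_powersetCard] using (Finset.mem_filter.1 hf).2.2)]
  rw [Finset.sum_congr rfl (g := fun _ => k ^ (n - k)), Finset.sum_const,
    Finset.card_powersetCard, Finset.card_univ, Fintype.card_fin, smul_eq_mul]
  intro s hs
  obtain ⟨-, rfl⟩ := Finset.mem_powersetCard.1 hs
  have hcard := card_filter_idempotent_image_eq s
  rw [Fintype.card_fin] at hcard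
  rw [← hcard, Finset.filter_filter]
  congr 1
  ext f
  simp only [Finset.mem_filter, Finset.mem_univ, true_and]
  exact ⟨fun h => ⟨h.1.1, h.2⟩, fun h => ⟨⟨h.1, congrArg Finset.card h.2⟩, h.2⟩⟩
end

section
/- For every function f from [n] to itself, there exists a permutation σ of [n] such that the composition f ∘ σ is idempotent. -/
/-- Every self-map of a finite type has a permutation which is a section of it over its range. -/
theorem exists_perm_apply_eq_of_mem_range {α : Type*} [Finite α] (f : α → α) :
    ∃ σ : Equiv.Perm α, ∀ y ∈ Set.range f, f (σ y) = y := by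
  classical
  have := Fintype.ofFinite α
  let e : {x // x ∈ Set.range f} ≃ {x // x ∈ Set.range (Set.rangeSplitting f)} :=
    Equiv.ofInjective _ (Set.rangeSplitting_injective f)
  refine ⟨e.extendSubtype, fun y hy => ?_⟩
  rw [e.extendSubtype_apply_of_mem y hy]
  exact Set.apply_rangeSplitting f ⟨y, hy⟩

/-- For every function `f` from `[n]` (modeled as `Fin n`) to itself there exists a
permutation `σ` of `[n]` such that `f ∘ σ` is idempotent. -/
theorem exists_perm_comp_idempotent (n : ℕ) (f : Fin n → Fin n) :
    ∃ σ : Equiv.Perm (Fin n), ∀ x, (f ∘ σ) ((f ∘ σ) x) = (f ∘ σ) x := by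
  obtain ⟨σ, hσ⟩ := exists_perm_apply_eq_of_mem_range f
  exact ⟨σ, fun x => hσ _ ⟨σ x, rfl⟩⟩
end

section
/- For every natural number n ≥ 1 and every k with 1 ≤ k ≤ n, the number of idempotent permutations of degree k on [n] equals C(n,k)·k^(n−k). -/
/-- `(π, A)` is an idempotent permutation on `[n]` (modeled as `Fin n`, so the
element `1` of `[n]` corresponds to `0 : Fin n`): writing `C = π(A)`,
(i) `π` is strictly increasing on `A`;
(ii) `1 ∈ C` (i.e. `C` contains the least element of `Fin n`);
(iii) for all `u, v ∉ C` with `u < v` such that no element of `C` lies in the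
half-open interval `(u, v]`, one has `π⁻¹(u) < π⁻¹(v)`. -/
def IsIdemPerm (n : ℕ) (π : Equiv.Perm (Fin n)) (A : Finset (Fin n)) : Prop :=
  (∀ a ∈ A, ∀ a' ∈ A, a < a' → π a < π a') ∧
  (∃ a ∈ A, (π a : ℕ) = 0) ∧
  (∀ u v : Fin n, u ∉ A.image π → v ∉ A.image π → u < v →
    (¬ ∃ c ∈ A.image π, u < c ∧ c ≤ v) → π.symm u < π.symm v)

/-- Extend a map from the complement of `A` to `A` by the identity on `A`. -/
def retraction {n : ℕ} {A : Finset (Fin n)} (g : {x // x ∉ A} → {x // x ∈ A}) (x : Fin n) :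
    Fin n :=
  if h : x ∈ A then x else g ⟨x, h⟩

/-- Numerical key ordering the fibres of the retraction along `A`, each fibre starting with its
element of `A` and continuing increasingly. -/
def fibreKey {n : ℕ} (A : Finset (Fin n)) (F : Fin n → Fin n) (x : Fin n) : ℕ :=
  (F x : ℕ) * (n + 1) + if x ∈ A then 0 else (x : ℕ) + 1

section

variable {n : ℕ} {A : Finset (Fin n)}

theorem retraction_mem (g : {x // x ∉ A} → {x // x ∈ A}) (x : Fin n) : retraction g x ∈ A := by
  unfold retraction
  split_ifs with h
  · exact h
  · exact (g ⟨x, h⟩).2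

theorem retraction_of_mem (g : {x // x ∉ A} → {x // x ∈ A}) {x : Fin n} (h : x ∈ A) :
    retraction g x = x := by
  simp [retraction, h]

theorem retraction_of_notMem (g : {x // x ∉ A} → {x // x ∈ A}) {x : Fin n} (h : x ∉ A) :
    retraction g x = g ⟨x, h⟩ := by
  simp [retraction, h]

theorem fibreKey_lt_of_lt {F : Fin n → Fin n} {x y : Fin n} (h : F x < F y) :
    fibreKey A F x < fibreKey A F y := by
  have h1 : (F x : ℕ) + 1 ≤ F y := h
  have h2 := Nat.mul_le_mul_right (n + 1) h1
  have hx := x.2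
  unfold fibreKey
  split_ifs <;> nlinarith

theorem le_of_fibreKey_le {F : Fin n → Fin n} {x y : Fin n}
    (h : fibreKey A F x ≤ fibreKey A F y) : F x ≤ F y := by
  by_contra! h'
  exact absurd (fibreKey_lt_of_lt (A := A) h') (by omega)

theorem fibreKey_le_iff {F : Fin n → Fin n} (hF : ∀ x ∈ A, F x = x) {a x : Fin n} (ha : a ∈ A) :
    fibreKey A F a ≤ fibreKey A F x ↔ a ≤ F x := by
  constructor
  · intro h
    simpa [hF a ha] using le_of_fibreKey_le h
  · intro h
    have h1 : (a : ℕ) ≤ F x := h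
    have h2 := Nat.mul_le_mul_right (n + 1) h1
    simp only [fibreKey, hF a ha, ha, if_true]
    omega

theorem fibreKey_injective {F : Fin n → Fin n} (hF : ∀ x ∈ A, F x = x) :
    Function.Injective (fibreKey A F) := by
  intro x y h
  have hxy : F x = F y := le_antisymm (le_of_fibreKey_le h.le) (le_of_fibreKey_le h.ge)
  unfold fibreKey at h
  rw [hxy] at h
  split_ifs at h with hx hy hy
  · rwa [hF x hx, hF y hy] at hxy
  · omega
  · omega
  · exact Fin.ext (by omega)

/-- A permutation is determined by the order it induces. -/
theorem perm_eq_of_lt_imp_lt {π τ : Equiv.Perm (Fin n)} (h : ∀ x y, π x < π y → τ x < τ y) :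
    π = τ := by
  have hm : StrictMono (τ ∘ π.symm) := by
    intro u v huv
    exact h _ _ (by simpa using huv)
  have hid : τ ∘ π.symm = id :=
    hm.range_inj strictMono_id |>.1 (by
      rw [(τ.surjective.comp π.symm.surjective).range_eq, Set.range_id])
  ext x
  have := congrFun hid (π x)
  simp at this
  rw [this]

theorem exists_perm_lt_iff {f : Fin n → ℕ} (hf : Function.Injective f) :
    ∃ π : Equiv.Perm (Fin n), ∀ x y, π x < π y ↔ f x < f y := by
  have hs : StrictMono (f ∘ Tuple.sort f) :=
    (Tuple.monotone_sort f).strictMono_of_injective (hf.comp (Tuple.sort f).injective)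
  refine ⟨(Tuple.sort f).symm, fun x y => ?_⟩
  rw [← hs.lt_iff_lt]
  simp

theorem isIdemPerm_of_lt_iff (hA : A.Nonempty) {F : Fin n → Fin n} (hFA : ∀ x, F x ∈ A)
    (hF : ∀ x ∈ A, F x = x) {π : Equiv.Perm (Fin n)}
    (hπ : ∀ x y, π x < π y ↔ fibreKey A F x < fibreKey A F y) : IsIdemPerm n π A := by
  have hle : ∀ x y, π x ≤ π y ↔ fibreKey A F x ≤ fibreKey A F y := fun x y => by
    rw [← not_lt, hπ, not_lt]
  refine ⟨fun a ha b hb hab => ?_, ?_, fun u v hu hv huv hc => ?_⟩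
  · rw [hπ]
    exact fibreKey_lt_of_lt (by rwa [hF a ha, hF b hb])
  · obtain ⟨b, -⟩ := hA
    have hn : 0 < n := b.pos
    refine ⟨F (π.symm ⟨0, hn⟩), hFA _, ?_⟩
    have h := (hle (F (π.symm ⟨0, hn⟩)) (π.symm ⟨0, hn⟩)).2
      ((fibreKey_le_iff hF (hFA _)).2 le_rfl)
    rw [Equiv.apply_symm_apply] at h
    exact Nat.le_zero.1 h
  · obtain ⟨x, rfl⟩ := π.surjective u
    obtain ⟨y, rfl⟩ := π.surjective v
    have hx : x ∉ A := fun h => hu (Finset.mem_image_of_mem _ h)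
    have hy : y ∉ A := fun h => hv (Finset.mem_image_of_mem _ h)
    have hk := (hπ x y).1 huv
    have hxy : F x = F y := by
      refine (le_of_fibreKey_le hk.le).eq_of_not_lt fun hlt => hc ?_
      refine ⟨π (F y), Finset.mem_image_of_mem _ (hFA y), ?_, ?_⟩
      · rw [hπ]
        exact fibreKey_lt_of_lt (by rwa [hF _ (hFA y)])
      · rw [hle]
        exact (fibreKey_le_iff hF (hFA _)).2 le_rfl
    simp only [fibreKey, hxy, hx, hy, if_false] at hk
    simp only [Equiv.symm_apply_apply]
    exact Fin.lt_def.2 (by omega)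

/-- Every idempotent permutation arises by ordering the fibres of a retraction. -/
theorem IsIdemPerm.exists_retraction {π : Equiv.Perm (Fin n)} (h : IsIdemPerm n π A) :
    ∃ g : {x // x ∉ A} → {x // x ∈ A}, ∀ x y, π x < π y →
      fibreKey A (retraction g) x < fibreKey A (retraction g) y := by
  obtain ⟨h1, ⟨z, hz, hz0⟩, h3⟩ := h
  have hex : ∀ x, ∃ a ∈ A, π a ≤ π x ∧ ∀ b ∈ A, π b ≤ π x → π b ≤ π a := by
    intro x
    obtain ⟨a, ha, hmax⟩ := (A.filter fun a => π a ≤ π x).exists_max_image π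
      ⟨z, Finset.mem_filter.2 ⟨hz, Fin.le_def.2 (by omega)⟩⟩
    rw [Finset.mem_filter] at ha
    exact ⟨a, ha.1, ha.2, fun b hb hbx => hmax b (Finset.mem_filter.2 ⟨hb, hbx⟩)⟩
  choose G hGA hGle hGmax using hex
  have hG : retraction (A := A) (fun x => ⟨G x, hGA x⟩) = G := by
    funext x
    by_cases hx : x ∈ A
    · rw [retraction_of_mem _ hx]
      exact π.injective (le_antisymm (hGmax x x hx le_rfl) (hGle x))
    · rw [retraction_of_notMem _ hx]
  refine ⟨fun x => ⟨G x, hGA x⟩, fun x y hxy => ?_⟩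
  rw [hG]
  have hle : G x ≤ G y := by
    by_contra! hlt
    exact absurd (h1 _ (hGA y) _ (hGA x) hlt)
      (not_lt.2 (hGmax y _ (hGA x) ((hGle x).trans hxy.le)))
  rcases hle.lt_or_eq with hlt | heq
  · exact fibreKey_lt_of_lt hlt
  · have hy : y ∉ A := fun hy =>
      absurd (hGmax y y hy le_rfl) (not_le.2 (heq ▸ (hGle x).trans_lt hxy))
    by_cases hx : x ∈ A
    · simp [fibreKey, heq, hx, hy]
    · have hlt : x < y := by
        have := h3 (π x) (π y) (by simpa using hx) (by simpa using hy) hxy ?_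
        · simpa using this
        · rintro ⟨c, hc, hxc, hcy⟩
          obtain ⟨a, ha, rfl⟩ := Finset.mem_image.1 hc
          exact absurd ((hGmax y a ha hcy).trans (heq ▸ hGle x)) (not_le.2 hxc)
      simpa [fibreKey, heq, hx, hy] using hlt

theorem card_isIdemPerm (hA : A.Nonempty) :
    Nat.card {π : Equiv.Perm (Fin n) // IsIdemPerm n π A} = A.card ^ (n - A.card) := by
  choose P hP using fun g : {x // x ∉ A} → {x // x ∈ A} =>
    exists_perm_lt_iff (fibreKey_injective (A := A) fun _ => retraction_of_mem g)
  have hI : ∀ g, IsIdemPerm n (P g) A := fun g =>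
    isIdemPerm_of_lt_iff hA (retraction_mem g) (fun _ => retraction_of_mem g) (hP g)
  have hbij : Function.Bijective
      (fun g => (⟨P g, hI g⟩ : {π : Equiv.Perm (Fin n) // IsIdemPerm n π A})) := by
    constructor
    · intro g g' hgg
      have hPP : P g = P g' := congrArg Subtype.val hgg
      have hle : ∀ g x a, a ∈ A → (P g a ≤ P g x ↔ a ≤ retraction g x) := fun g x a ha => by
        rw [← fibreKey_le_iff (fun _ => retraction_of_mem g) ha, ← not_lt, hP, not_lt]
      have hr : ∀ x, retraction g x = retraction g' x := fun x => by
        apply le_antisymm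
        · rw [← hle _ _ _ (retraction_mem g x), ← hPP, hle _ _ _ (retraction_mem g x)]
        · rw [← hle _ _ _ (retraction_mem g' x), hPP, hle _ _ _ (retraction_mem g' x)]
      funext ⟨x, hx⟩
      have := hr x
      rw [retraction_of_notMem _ hx, retraction_of_notMem _ hx] at this
      exact Subtype.ext this
    · rintro ⟨π, hπ⟩
      obtain ⟨g, hg⟩ := hπ.exists_retraction
      exact ⟨g, Subtype.ext (perm_eq_of_lt_imp_lt fun x y hxy => (hP g x y).2 (hg x y hxy)).symm⟩
  rw [← Nat.card_eq_of_bijective _ hbij]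
  simp [Nat.card_eq_fintype_card, Fintype.card_subtype_compl]

end

/-- The number of idempotent permutations of degree `k` on `[n]` equals
`C(n,k) · k^(n-k)`. -/
theorem card_idemPerm_degree (n k : ℕ) (hn : 1 ≤ n) (hk1 : 1 ≤ k) (hkn : k ≤ n) :
    Nat.card {p : Equiv.Perm (Fin n) × Finset (Fin n) //
        p.2.card = k ∧ IsIdemPerm n p.1 p.2} =
      n.choose k * k ^ (n - k) := by
  let e : {p : Equiv.Perm (Fin n) × Finset (Fin n) // p.2.card = k ∧ IsIdemPerm n p.1 p.2} ≃
      Σ A : {A : Finset (Fin n) // A.card = k},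
        {π : Equiv.Perm (Fin n) // IsIdemPerm n π A.1} :=
    { toFun := fun p => ⟨⟨p.1.2, p.2.1⟩, ⟨p.1.1, p.2.2⟩⟩
      invFun := fun q => ⟨(q.2.1, q.1.1), q.1.2, q.2.2⟩
      left_inv := fun _ => rfl
      right_inv := fun _ => rfl }
  rw [Nat.card_congr e, Nat.card_sigma]
  have hcard : ∀ A : {A : Finset (Fin n) // A.card = k},
      Nat.card {π : Equiv.Perm (Fin n) // IsIdemPerm n π A.1} = k ^ (n - k) := by
    rintro ⟨A, rfl⟩
    exact card_isIdemPerm (Finset.card_pos.1 hk1)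
  simp [hcard]
end

section
/- For every multiset m of cardinality n with elements drawn from [n], there exists an idempotent function f from [n] to itself whose multiset of values {f(1), f(2), …, f(n)} (counted with multiplicity) equals m. -/
/-- Any multiset with as many elements as a finset `s` is the multiset of values on `s` of
some function. -/
theorem Finset.exists_map_val_eq_of_card_eq {α : Type*} [DecidableEq α] (s : Finset α)
    (r : Multiset α) (h : Multiset.card r = s.card) :
    ∃ g : α → α, Multiset.map g s.val = r := by
  induction s using Finset.induction_on generalizing r with
  | empty => exact ⟨id, by simpa [eq_comm] using h⟩
  | insert a s ha ih =>
    rw [Finset.card_insert_of_notMem ha] at h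
    obtain ⟨b, hb⟩ := Multiset.card_pos_iff_exists_mem.mp
      (h.symm ▸ Nat.succ_pos s.card : 0 < Multiset.card r)
    obtain ⟨t, rfl⟩ := Multiset.exists_cons_of_mem hb
    obtain ⟨g, rfl⟩ := ih t (Nat.succ_injective (by rwa [Multiset.card_cons] at h))
    refine ⟨Function.update g a b, ?_⟩
    rw [Finset.insert_val_of_notMem ha, Multiset.map_cons, Function.update_self]
    congr 1
    refine Multiset.map_congr rfl fun x hx => Function.update_of_ne ?_ _ _
    rintro rfl
    exact ha hx

/-- For every multiset `m` of cardinality `n` over `[n]` (modeled as `Fin n`), there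
exists an idempotent function `f : [n] → [n]` whose multiset of values
`{f(1), …, f(n)}` (with multiplicity) equals `m`. -/
theorem exists_idempotent_with_value_multiset (n : ℕ) (m : Multiset (Fin n))
    (hm : Multiset.card m = n) :
    ∃ f : Fin n → Fin n, (∀ x, f (f x) = f x) ∧
      Multiset.map f Finset.univ.val = m := by
  have hle : m.toFinset.val ≤ m := Multiset.dedup_le m
  obtain ⟨g, hg⟩ := Finset.exists_map_val_eq_of_card_eq m.toFinsetᶜ (m - m.toFinset.val) (by
    rw [Multiset.card_sub hle, Finset.card_compl, Fintype.card_fin, hm, Finset.card_def])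
  have hgm : ∀ x, x ∉ m.toFinset → g x ∈ m.toFinset := fun x hx => by
    have : g x ∈ m - m.toFinset.val :=
      hg ▸ Multiset.mem_map_of_mem g (Finset.mem_compl.mpr hx)
    exact Multiset.mem_toFinset.mpr (Multiset.mem_of_le tsub_le_self this)
  refine ⟨fun x => if x ∈ m.toFinset then x else g x, fun x => ?_, ?_⟩
  · by_cases hx : x ∈ m.toFinset
    · simp only [if_pos hx]
    · simp only [if_neg hx, if_pos (hgm x hx)]
  · have huniv : (Finset.univ : Finset (Fin n)).val = m.toFinset.val + m.toFinsetᶜ.val := by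
      rw [← Finset.disjUnion_val _ _ disjoint_compl_right, Finset.disjUnion_eq_union,
        Finset.union_compl]
    have hS : m.toFinset.val.map (fun x => if x ∈ m.toFinset then x else g x) =
        m.toFinset.val.map id := Multiset.map_congr rfl fun x hx => if_pos (Finset.mem_val.mp hx)
    have hSc : m.toFinsetᶜ.val.map (fun x => if x ∈ m.toFinset then x else g x) =
        m.toFinsetᶜ.val.map g :=
      Multiset.map_congr rfl fun x hx => if_neg (Finset.mem_compl.mp hx)
    rw [huniv, Multiset.map_add, hS, hSc, Multiset.map_id, hg, add_tsub_cancel_of_le hle]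
end

section
/- Let m be a multiset of cardinality n with elements drawn from [n] having exactly k distinct elements, and let N be the number of idempotent functions f from [n] to itself whose multiset of values {f(1), …, f(n)} (with multiplicity) equals m. Then N multiplied by the product, over all distinct elements a of m, of (mult_m(a) − 1)! equals (n − k)!, where mult_m(a) denotes the multiplicity of a in m. -/
open Finset

/-- The multiset of values of `f` records the cardinalities of its fibers. -/
lemma Multiset.count_map_univ {α β : Type*} [Fintype α] [DecidableEq β] (f : α → β) (b : β)
    [Fintype {x // f x = b}] : (Multiset.map f univ.val).count b = Fintype.card {x // f x = b} := by
  rw [Multiset.count_map, Fintype.card_subtype, Finset.card_def, Finset.filter_val]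
  simp only [eq_comm]

/-- Every multiset is the multiset of values of a function on a type of the right cardinality. -/
lemma Multiset.exists_map_univ_eq {α β : Type*} [Fintype α] (m : Multiset β)
    (hm : Multiset.card m = Fintype.card α) :
    ∃ f : α → β, Multiset.map f univ.val = m := by
  classical
  let e : α ≃ m := Fintype.equivOfCardEq (by rw [Multiset.card_coe, hm])
  refine ⟨fun x ↦ (e x).1, ?_⟩
  calc Multiset.map (fun x ↦ (e x).1) univ.val
      = Multiset.map (fun y : m ↦ y.1) (Multiset.map e univ.val) := by
        rw [Multiset.map_map]; rfl
    _ = m := by rw [Multiset.map_univ_val_equiv, Multiset.map_univ_coe]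

/-- Two functions with the same multiset of values differ by a permutation of the source. -/
lemma exists_perm_comp_eq_of_map_univ_eq {α β : Type*} [Fintype α] {f g : α → β}
    (h : Multiset.map f univ.val = Multiset.map g univ.val) :
    ∃ σ : Equiv.Perm α, g ∘ σ = f := by
  classical
  have hcard (b : β) : Fintype.card {x // f x = b} = Fintype.card {x // g x = b} := by
    rw [← Multiset.count_map_univ, ← Multiset.count_map_univ, h]
  let e (b : β) : {x // f x = b} ≃ {x // g x = b} := Fintype.equivOfCardEq (hcard b)
  exact ⟨Equiv.ofFiberEquiv e, funext fun x ↦ Equiv.ofFiberEquiv_map e x⟩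

/-- The number of functions with a prescribed multiset of values. -/
lemma card_map_univ_eq_mul_prod_factorial {α β : Type*} [Fintype α] [Fintype β] [DecidableEq β]
    (m : Multiset β) (hm : Multiset.card m = Fintype.card α) :
    Nat.card {f : α → β // Multiset.map f univ.val = m} * ∏ b, (m.count b).factorial =
      (Fintype.card α).factorial := by
  classical
  obtain ⟨g, rfl⟩ := Multiset.exists_map_univ_eq m hm
  have hcomp (σ : Equiv.Perm α) :
      Multiset.map (g ∘ σ) univ.val = Multiset.map g univ.val := by
    rw [← Multiset.map_map, Multiset.map_univ_val_equiv]
  let p : Equiv.Perm α → {f : α → β // Multiset.map f univ.val = Multiset.map g univ.val} :=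
    fun σ ↦ ⟨g ∘ σ, hcomp σ⟩
  have hfiber (f) : Fintype.card {σ // p σ = f} =
      ∏ b, ((Multiset.map g univ.val).count b).factorial := by
    obtain ⟨τ, hτ⟩ := exists_perm_comp_eq_of_map_univ_eq f.2
    simp only [Multiset.count_map_univ]
    rw [← DomMulAct.stabilizer_card g]
    refine Fintype.card_congr ((Equiv.mulRight τ⁻¹).subtypeEquiv fun σ ↦ ?_)
    rw [Subtype.ext_iff, ← hτ, Equiv.coe_mulRight]
    constructor
    · intro h
      funext x
      simpa [p] using congrFun h (τ⁻¹ x)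
    · intro h
      funext x
      simpa [p] using congrFun h (τ x)
  rw [← Fintype.card_perm, ← Fintype.card_congr (Equiv.sigmaFiberEquiv p), Fintype.card_sigma,
    Finset.sum_congr rfl fun f _ ↦ hfiber f, Finset.sum_const, smul_eq_mul, Finset.card_univ,
    Nat.card_eq_fintype_card]

/-- The multiset of values splits over a finset of the source and its complement. -/
lemma Multiset.map_univ_eq_add {α β : Type*} [Fintype α] [DecidableEq α] (f : α → β)
    (s : Finset α) :
    Multiset.map f univ.val =
      Multiset.map f s.val + Multiset.map (fun x : {x // x ∉ s} ↦ f x) univ.val := by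
  have hcompl : Multiset.map (fun x : {x // x ∉ s} ↦ (x : α)) univ.val = sᶜ.val := by
    have h : (univ : Finset {x // x ∉ s}).map (Function.Embedding.subtype _) = sᶜ := by
      ext x; simp
    rw [← h]; rfl
  have hadd : (univ : Finset α).val = s.val + sᶜ.val := by
    rw [← Finset.disjUnion_val s sᶜ disjoint_compl_right, Finset.disjUnion_eq_union,
      Finset.union_compl]
  rw [hadd, Multiset.map_add, ← hcompl, Multiset.map_map]
  rfl

/-- An idempotent function is determined by its values off its image; these can be any elements
of the image. -/
def idempotentEquivMapCompl {α : Type*} [Fintype α] [DecidableEq α] (m : Multiset α) :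
    {f : α → α // (∀ x, f (f x) = f x) ∧ Multiset.map f univ.val = m} ≃
      {g : {x // x ∉ m.toFinset} → α // m.toFinset.val + Multiset.map g univ.val = m} where
  toFun f := ⟨fun x ↦ f.1 x, by
    obtain ⟨f, hf, hm⟩ := f
    have hfix : ∀ x ∈ m.toFinset.val, f x = x := by
      intro x hx
      rw [Finset.mem_val, Multiset.mem_toFinset, ← hm, Multiset.mem_map] at hx
      obtain ⟨y, -, rfl⟩ := hx
      exact hf y
    have h := Multiset.map_univ_eq_add f m.toFinset
    rw [Multiset.map_congr rfl hfix, Multiset.map_id', hm] at h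
    exact h.symm⟩
  invFun g := ⟨fun x ↦ if h : x ∈ m.toFinset then x else g.1 ⟨x, h⟩, by
    obtain ⟨g, hg⟩ := g
    have hmem (x) : g x ∈ m.toFinset := by
      rw [Multiset.mem_toFinset, ← hg]
      exact Multiset.mem_add.2 (Or.inr (Multiset.mem_map_of_mem g (Finset.mem_univ x)))
    constructor
    · intro x
      by_cases h : x ∈ m.toFinset
      · simp only [h, dite_true]
      · simp only [h, dite_false, hmem, dite_true]
    · rw [Multiset.map_univ_eq_add _ m.toFinset]
      conv_rhs => rw [← hg]
      congr 1
      · conv_rhs => rw [← Multiset.map_id' m.toFinset.val]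
        exact Multiset.map_congr rfl fun x hx ↦ dif_pos hx
      · exact Multiset.map_congr rfl fun x _ ↦ dif_neg x.2⟩
  left_inv := by
    rintro ⟨f, hf, hm⟩
    ext x
    by_cases h : x ∈ m.toFinset
    · have h' := h
      rw [Multiset.mem_toFinset, ← hm, Multiset.mem_map] at h'
      obtain ⟨y, -, rfl⟩ := h'
      simp only [h, dite_true, hf]
    · simp only [h, dite_false]
  right_inv := by
    rintro ⟨g, hg⟩
    ext x
    exact dif_neg x.2

/-- Let `m` be a multiset of cardinality `n` over `[n]` (modeled as `Fin n`) with
exactly `k` distinct elements, and let `N` be the number of idempotent functions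
`f : [n] → [n]` whose multiset of values equals `m`.  Then
`N · ∏_{a ∈ m distinct} (mult_m(a) - 1)! = (n - k)!`. -/
theorem card_idempotent_with_value_multiset (n k : ℕ) (m : Multiset (Fin n))
    (hm : Multiset.card m = n) (hk : m.toFinset.card = k) :
    Nat.card {f : Fin n → Fin n //
        (∀ x, f (f x) = f x) ∧ Multiset.map f Finset.univ.val = m} *
      ∏ a ∈ m.toFinset, (m.count a - 1).factorial = (n - k).factorial := by
  obtain ⟨r, hr⟩ := Multiset.le_iff_exists_add.1 (Multiset.dedup_le m)
  rw [← Multiset.toFinset_val] at hr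
  have hcompl : Fintype.card {x // x ∉ m.toFinset} = n - k := by
    rw [Fintype.card_subtype_compl, Fintype.card_fin, Fintype.card_coe, hk]
  have hcard : Multiset.card r = Fintype.card {x // x ∉ m.toFinset} := by
    have h := congrArg Multiset.card hr
    rw [Multiset.card_add, Finset.card_val, hm, hk] at h
    omega
  have hfun (g : {x // x ∉ m.toFinset} → Fin n) :
      m.toFinset.val + Multiset.map g univ.val = m ↔ Multiset.map g univ.val = r := by
    conv_lhs => rhs; rw [hr]
    exact add_right_inj _
  have hcount (a : Fin n) : r.count a = m.count a - 1 := by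
    have h := congrArg (Multiset.count a) hr
    rw [Multiset.count_add, Multiset.toFinset_val, Multiset.count_dedup] at h
    split_ifs at h with ha
    · omega
    · rw [Multiset.count_eq_zero_of_notMem ha] at h ⊢
      omega
  have hprod : ∏ a ∈ m.toFinset, (m.count a - 1).factorial = ∏ a, (r.count a).factorial := by
    simp only [hcount]
    refine Finset.prod_subset (Finset.subset_univ _) fun a _ ha ↦ ?_
    rw [Multiset.mem_toFinset] at ha
    rw [Multiset.count_eq_zero_of_notMem ha, Nat.zero_sub, Nat.factorial_zero]
  rw [Nat.card_congr ((idempotentEquivMapCompl m).trans (Equiv.subtypeEquivRight hfun)), hprod,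
    card_map_univ_eq_mul_prod_factorial r hcard, hcompl]
end

section
/- For every natural number n ≥ 1 and every k with 1 ≤ k ≤ n, the set of idempotent permutations of degree k on [n] and the set of idempotent functions from [n] to itself whose image has exactly k elements have the same cardinality. -/
/-- Sorting `Fin n` by this key lists the fibres of `f` in the order of their values, each fibre
beginning with its fixed point. -/
def fiberKey {n : ℕ} (f : Fin n → Fin n) (x : Fin n) : ℕ :=
  2 * (f x : ℕ) + if f x = x then 0 else 1

theorem sort_symm_lt_iff {n : ℕ} {α : Type*} [LinearOrder α] (g : Fin n → α) (x y : Fin n) :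
    (Tuple.sort g).symm x < (Tuple.sort g).symm y ↔ g x < g y ∨ (g x = g y ∧ x < y) := by
  have key : ∀ x y, (Tuple.sort g).symm x < (Tuple.sort g).symm y →
      g x < g y ∨ (g x = g y ∧ x < y) := by
    intro x y h
    obtain ⟨hm, ht⟩ := (Tuple.eq_sort_iff (f := g)).1 rfl
    have h1 := hm h.le
    have h2 := ht _ _ h
    simp only [Function.comp_apply, Equiv.apply_symm_apply] at h1 h2
    exact h1.lt_or_eq.imp_right fun e => ⟨e, h2 e⟩
  refine ⟨key x y, fun h => ?_⟩
  by_contra hn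
  rcases (not_lt.1 hn).lt_or_eq with h' | h'
  · rcases key y x h' with h1 | ⟨h1, h2⟩ <;> rcases h with h3 | ⟨h3, h4⟩
    · exact lt_asymm h1 h3
    · exact h1.ne' h3
    · exact h3.ne' h1
    · exact lt_asymm h2 h4
  · have := (Tuple.sort g).symm.injective h'
    subst this
    simp at h

theorem mem_image_univ_iff_of_idempotent {n : ℕ} {f : Fin n → Fin n} (hf : ∀ x, f (f x) = f x)
    (x : Fin n) : x ∈ Finset.univ.image f ↔ f x = x := by
  simp only [Finset.mem_image, Finset.mem_univ, true_and]
  exact ⟨by rintro ⟨y, rfl⟩; exact hf y, fun h => ⟨x, h⟩⟩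

theorem fiberKey_of_fixed {n : ℕ} {f : Fin n → Fin n} {x : Fin n} (h : f x = x) :
    fiberKey f x = 2 * (x : ℕ) := by
  simp [fiberKey, h]

theorem fiberKey_of_not_fixed {n : ℕ} {f : Fin n → Fin n} {x : Fin n} (h : f x ≠ x) :
    fiberKey f x = 2 * (f x : ℕ) + 1 := by
  simp [fiberKey, h]

theorem isIdemPerm_sort_fiberKey {n : ℕ} (hn : 1 ≤ n) {f : Fin n → Fin n}
    (hf : ∀ x, f (f x) = f x) :
    IsIdemPerm n (Tuple.sort (fiberKey f)).symm (Finset.univ.image f) := by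
  refine ⟨fun a ha b hb hab => ?_, ?_, fun u v hu hv huv hc => ?_⟩
  · rw [mem_image_univ_iff_of_idempotent hf] at ha hb
    rw [sort_symm_lt_iff, fiberKey_of_fixed ha, fiberKey_of_fixed hb]
    omega
  · have h0 : ((Tuple.sort (fiberKey f)).symm
        (Tuple.sort (fiberKey f) ⟨0, hn⟩) : ℕ) = 0 := by simp
    refine ⟨_, ?_, h0⟩
    rw [mem_image_univ_iff_of_idempotent hf]
    by_contra hne
    have hlt := (sort_symm_lt_iff (fiberKey f) (f (Tuple.sort (fiberKey f) ⟨0, hn⟩))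
      (Tuple.sort (fiberKey f) ⟨0, hn⟩)).2 (Or.inl (by
        rw [fiberKey_of_fixed (hf _), fiberKey_of_not_fixed hne]; omega))
    rw [Fin.lt_def] at hlt
    omega
  · obtain ⟨x, rfl⟩ := (Tuple.sort (fiberKey f)).symm.surjective u
    obtain ⟨y, rfl⟩ := (Tuple.sort (fiberKey f)).symm.surjective v
    rw [(Tuple.sort (fiberKey f)).symm.injective.mem_finset_image,
      mem_image_univ_iff_of_idempotent hf] at hu hv
    simp only [Equiv.symm_apply_apply]
    rcases (sort_symm_lt_iff _ _ _).1 huv with h | h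
    · refine absurd ⟨(Tuple.sort (fiberKey f)).symm (f y), Finset.mem_image_of_mem _
        (Finset.mem_image_of_mem _ (Finset.mem_univ y)), ?_, le_of_lt ?_⟩ hc
      all_goals
        rw [fiberKey_of_not_fixed hu, fiberKey_of_not_fixed hv] at h
        rw [sort_symm_lt_iff, fiberKey_of_fixed (hf y)]
      · rw [fiberKey_of_not_fixed hu]; omega
      · rw [fiberKey_of_not_fixed hv]; omega
    · exact h.2

theorem le_of_sort_fiberKey_eq {n : ℕ} {f g : Fin n → Fin n} (hf : ∀ x, f (f x) = f x)
    (hg : ∀ x, g (g x) = g x) (hs : Tuple.sort (fiberKey f) = Tuple.sort (fiberKey g))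
    (hi : Finset.univ.image f = Finset.univ.image g) (x : Fin n) : g x ≤ f x := by
  have hfix : ∀ y, f y = y ↔ g y = y := fun y => by
    rw [← mem_image_univ_iff_of_idempotent hf, ← mem_image_univ_iff_of_idempotent hg, hi]
  by_contra! hlt
  by_cases hx : f x = x
  · rw [hx, (hfix x).1 hx] at hlt
    exact lt_irrefl _ hlt
  · have h1 := (sort_symm_lt_iff (fiberKey f) x (g x)).2 (Or.inl (by
      rw [fiberKey_of_not_fixed hx, fiberKey_of_fixed ((hfix _).2 (hg x))]; omega))
    have h2 := (sort_symm_lt_iff (fiberKey g) (g x) x).2 (Or.inl (by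
      rw [fiberKey_of_not_fixed (mt (hfix x).2 hx), fiberKey_of_fixed (hg x)]; omega))
    rw [hs] at h1
    exact lt_asymm h1 h2

theorem IsIdemPerm.exists_idempotent {n : ℕ} {π : Equiv.Perm (Fin n)} {A : Finset (Fin n)}
    (h : IsIdemPerm n π A) :
    ∃ f : Fin n → Fin n, (∀ x, f (f x) = f x) ∧ Finset.univ.image f = A ∧
      (Tuple.sort (fiberKey f)).symm = π := by
  obtain ⟨hmono, ⟨a₀, ha₀, hzero⟩, hblock⟩ := h
  have hex : ∀ x, ∃ a ∈ A, π a ≤ π x ∧ ∀ b ∈ A, π b ≤ π x → π b ≤ π a := by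
    intro x
    obtain ⟨a, ha, hmax⟩ := Finset.exists_max_image (A.filter fun a => π a ≤ π x) π
      ⟨a₀, Finset.mem_filter.2 ⟨ha₀, Fin.le_def.2 (by omega)⟩⟩
    rw [Finset.mem_filter] at ha
    exact ⟨a, ha.1, ha.2, fun b hb hbx => hmax b (Finset.mem_filter.2 ⟨hb, hbx⟩)⟩
  choose f hfA hfle hfmax using hex
  have hfix : ∀ a ∈ A, f a = a := fun a ha =>
    π.injective (le_antisymm (hfle a) (hfmax a a ha le_rfl))
  have hfix' : ∀ a, f a ≠ a → a ∉ A := fun a => mt (hfix a)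
  refine ⟨f, fun x => hfix _ (hfA x), ?_, ?_⟩
  · ext a
    rw [mem_image_univ_iff_of_idempotent fun x => hfix _ (hfA x)]
    exact ⟨fun e => e ▸ hfA a, hfix a⟩
  · have hle : ∀ x y, π x < π y → f x ≤ f y := by
      intro x y hxy
      by_contra! hlt
      exact absurd (hfmax y _ (hfA x) ((hfle x).trans hxy.le))
        (not_le.2 (hmono _ (hfA y) _ (hfA x) hlt))
    have hne : ∀ x y, π x < π y → f x ≠ y := by
      rintro x _ hxy rfl
      exact absurd (hfle x) (not_le.2 hxy)
    have hsort : π.symm = Tuple.sort (fiberKey f) := by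
      rw [Tuple.eq_sort_iff]
      refine ⟨monotone_iff_forall_lt.2 fun i j hij => ?_, fun i j hij he => ?_⟩
      all_goals
        obtain ⟨x, rfl⟩ := π.surjective i
        obtain ⟨y, rfl⟩ := π.surjective j
        have h1 := hle x y hij
        have h2 := hne x y hij
        simp only [Function.comp_apply, Equiv.symm_apply_apply] at *
      · rcases h1.lt_or_eq with h3 | h3
        · unfold fiberKey
          split_ifs <;> omega
        · have h4 : f y ≠ y := h3 ▸ h2
          rw [fiberKey_of_not_fixed h4, fiberKey, h3]
          split_ifs <;> omega
      · have h3 : f x = f y := by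
          unfold fiberKey at he
          split_ifs at he <;> omega
        have h4 : f y ≠ y := h3 ▸ h2
        have h5 : f x ≠ x := by
          intro hx
          rw [fiberKey_of_not_fixed h4, fiberKey_of_fixed hx] at he
          omega
        have h6 := hblock (π x) (π y) (by rw [π.injective.mem_finset_image]; exact hfix' x h5)
          (by rw [π.injective.mem_finset_image]; exact hfix' y h4) hij (by
            rintro ⟨c, hc, hxc, hcy⟩
            obtain ⟨a, ha, rfl⟩ := Finset.mem_image.1 hc
            have h7 := hfmax y a ha hcy
            rw [← h3] at h7
            exact absurd (h7.trans (hfle x)) (not_le.2 hxc))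
        simpa using h6
    rw [← hsort, Equiv.symm_symm]

/-- The set of idempotent permutations of degree `k` on `[n]` and the set of
idempotent functions from `[n]` to itself whose image has exactly `k` elements
have the same cardinality. -/
theorem card_idemPerm_eq_card_idempotent (n k : ℕ) (hn : 1 ≤ n)
    (hk1 : 1 ≤ k) (hkn : k ≤ n) :
    Nat.card {p : Equiv.Perm (Fin n) × Finset (Fin n) //
        p.2.card = k ∧ IsIdemPerm n p.1 p.2} =
      Nat.card {f : Fin n → Fin n //
        (∀ x, f (f x) = f x) ∧ (Finset.univ.image f).card = k} := by
  symm
  refine Nat.card_eq_of_bijective (fun f => ⟨((Tuple.sort (fiberKey f.1)).symm,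
    Finset.univ.image f.1), f.2.2, isIdemPerm_sort_fiberKey hn f.2.1⟩) ⟨?_, ?_⟩
  · rintro ⟨f, hf, _⟩ ⟨g, hg, _⟩ h
    simp only [Subtype.mk.injEq, Prod.mk.injEq] at h
    have hs : Tuple.sort (fiberKey f) = Tuple.sort (fiberKey g) := by
      simpa using congrArg Equiv.symm h.1
    exact Subtype.ext (funext fun x => le_antisymm
      (le_of_sort_fiberKey_eq hg hf hs.symm h.2.symm x) (le_of_sort_fiberKey_eq hf hg hs h.2 x))
  · rintro ⟨⟨π, A⟩, hA, h⟩
    obtain ⟨f, hf, rfl, rfl⟩ := h.exists_idempotent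
    exact ⟨⟨f, hf, hA⟩, rfl⟩
end

section
/- Let f be an idempotent function from [n] to itself and let σ be a permutation of [n] such that the sequence f(σ(1)), f(σ(2)), …, f(σ(n)) is nondecreasing and, for every fixed point a of f and every x ∈ [n] with f(x) = a, one has σ⁻¹(a) ≤ σ⁻¹(x). Then for every i ∈ [n], the set {j ∈ [n] : j ≤ i and f(σ(j)) = σ(j)} is nonempty, and f(σ(i)) = σ(j*), where j* is the maximum of this set. -/
/-- Let `f : [n] → [n]` be idempotent and `σ` a permutation of `[n]` such that
`f(σ(1)), …, f(σ(n))` is nondecreasing and, for every fixed point `a` of `f`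
and every `x` with `f x = a`, one has `σ⁻¹(a) ≤ σ⁻¹(x)`.  Then for every
`i ∈ [n]` the set `{j ≤ i | f(σ(j)) = σ(j)}` is nonempty and `f(σ(i)) = σ(j*)`,
where `j*` is the maximum of this set. -/
theorem idempotent_sorted_value_eq_last_fixed (n : ℕ) (f : Fin n → Fin n)
    (σ : Equiv.Perm (Fin n))
    (hf : ∀ x, f (f x) = f x)
    (hmono : Monotone (fun i => f (σ i)))
    (hstable : ∀ a : Fin n, f a = a → ∀ x : Fin n, f x = a → σ.symm a ≤ σ.symm x) :
    ∀ i : Fin n,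
      ∃ h : (Finset.univ.filter fun j : Fin n => j ≤ i ∧ f (σ j) = σ j).Nonempty,
        f (σ i) = σ ((Finset.univ.filter
          fun j : Fin n => j ≤ i ∧ f (σ j) = σ j).max' h) := by
  intro i
  set S := Finset.univ.filter fun j : Fin n => j ≤ i ∧ f (σ j) = σ j with hS
  have hk : σ.symm (f (σ i)) ∈ S := by
    have hle := hstable (f (σ i)) (hf _) (σ i) rfl
    rw [Equiv.symm_apply_apply] at hle
    simp [hS, hle, hf]
  have hne : S.Nonempty := ⟨_, hk⟩
  refine ⟨hne, ?_⟩
  obtain ⟨-, hle, hfix⟩ := Finset.mem_filter.mp (S.max'_mem hne)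
  have hlow : f (σ i) ≤ f (σ (S.max' hne)) := by
    simpa [hf] using hmono (S.le_max' _ hk)
  exact (hlow.antisymm (hmono hle)).trans hfix
end
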